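/- The closed ideal 𝔯 of representable operators on L₁[0,1] has a bounded right approximate identity; moreover this net can be chosen to consist of norm-one idempotent operators. -/

import Mathlib

open scoped TensorProduct ENNReal
open MeasureTheory Filter

noncomputable section

/-- Lebesgue measure on `ℝ` restricted to the unit interval `[0,1]`. -/
def μ01 : Measure ℝ := volume.restrict (Set.Icc 0 1)

/-- The complex Lebesgue space `L₁[0,1]`. -/
abbrev L1C : Type := Lp ℂ 1 μ01

/-- An operator `T : L₁[0,1] → E` is representable if there is a bounded, strongly
measurable `h : [0,1] → E` such that `T f = ∫₀¹ f(s) • h(s) ds` (a Bochner integral). -/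
def IsRepresentable {E : Type*} [NormedAddCommGroup E] [NormedSpace ℂ E]
    (T : L1C →L[ℂ] E) : Prop :=
  ∃ h : ℝ → E, StronglyMeasurable h ∧ (∃ C : ℝ, ∀ t ∈ Set.Icc (0:ℝ) 1, ‖h t‖ ≤ C) ∧
    ∀ f : L1C, T f = ∫ s, (f : ℝ → ℂ) s • h s ∂μ01

instance : IsProbabilityMeasure μ01 := ⟨by simp [μ01]⟩

section KernelOperator

variable {E : Type*} [NormedAddCommGroup E] [NormedSpace ℂ E]

lemma integrable_smul_kernel {h : ℝ → E} {C : ℝ} (hm : StronglyMeasurable h)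
    (hC : ∀ᵐ s ∂μ01, ‖h s‖ ≤ C) (f : L1C) :
    Integrable (fun s => (f : ℝ → ℂ) s • h s) μ01 :=
  (L1.integrable_coeFn f).smul_bdd C hm.aestronglyMeasurable hC

lemma norm_integral_smul_kernel_le {h : ℝ → E} {C : ℝ}
    (hC : ∀ᵐ s ∂μ01, ‖h s‖ ≤ C) (f : L1C) :
    ‖∫ s, (f : ℝ → ℂ) s • h s ∂μ01‖ ≤ C * ‖f‖ := by
  rw [L1.norm_eq_integral_norm, mul_comm, ← integral_mul_const]
  refine norm_integral_le_of_norm_le ((L1.integrable_coeFn f).norm.mul_const C) ?_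
  filter_upwards [hC] with s hs
  rw [norm_smul]
  gcongr

/-- The representable operator with kernel `h`. -/
def kernelOperator (h : ℝ → E) (C : ℝ) (hm : StronglyMeasurable h)
    (hC : ∀ᵐ s ∂μ01, ‖h s‖ ≤ C) : L1C →L[ℂ] E :=
  LinearMap.mkContinuous
    { toFun := fun f => ∫ s, (f : ℝ → ℂ) s • h s ∂μ01
      map_add' := fun f g => by
        rw [← integral_add (integrable_smul_kernel hm hC f) (integrable_smul_kernel hm hC g)]
        refine integral_congr_ae ?_
        filter_upwards [Lp.coeFn_add f g] with s hs
        rw [hs, Pi.add_apply, add_smul]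
      map_smul' := fun c f => by
        rw [RingHom.id_apply, ← integral_smul]
        refine integral_congr_ae ?_
        filter_upwards [Lp.coeFn_smul c f] with s hs
        rw [hs, Pi.smul_apply, smul_assoc] }
    C (norm_integral_smul_kernel_le hC)

lemma kernelOperator_apply {h : ℝ → E} {C : ℝ} (hm : StronglyMeasurable h)
    (hC : ∀ᵐ s ∂μ01, ‖h s‖ ≤ C) (f : L1C) :
    kernelOperator h C hm hC f = ∫ s, (f : ℝ → ℂ) s • h s ∂μ01 := rfl

lemma norm_kernelOperator_le {h : ℝ → E} {C : ℝ} (hm : StronglyMeasurable h)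
    (hC : ∀ᵐ s ∂μ01, ‖h s‖ ≤ C) (hC0 : 0 ≤ C) : ‖kernelOperator h C hm hC‖ ≤ C :=
  LinearMap.mkContinuous_norm_le _ hC0 _

lemma map_kernelOperator [CompleteSpace E] {G : Type*} [NormedAddCommGroup G] [NormedSpace ℂ G]
    [CompleteSpace G] {h : ℝ → E} {C : ℝ} (hm : StronglyMeasurable h)
    (hC : ∀ᵐ s ∂μ01, ‖h s‖ ≤ C) (T : E →L[ℂ] G) (f : L1C) :
    T (kernelOperator h C hm hC f) = ∫ s, (f : ℝ → ℂ) s • T (h s) ∂μ01 := by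
  rw [kernelOperator_apply, ← T.integral_comp_comm (integrable_smul_kernel hm hC f)]
  simp only [map_smul]

end KernelOperator

lemma StronglyMeasurable.exists_measurable_nat_dist_lt {α E : Type*} [MeasurableSpace α]
    [PseudoMetricSpace E] [Nonempty E] {h : α → E} (hm : StronglyMeasurable h) {δ : ℝ}
    (hδ : 0 < δ) :
    ∃ (n : α → ℕ) (c : ℕ → E), Measurable n ∧ ∀ s, dist (h s) (c (n s)) < δ := by
  classical
  obtain ⟨u, hu, hsub⟩ := hm.isSeparable_range
  rcases isEmpty_or_nonempty α with hα | ⟨⟨a⟩⟩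
  · exact ⟨fun _ => 0, fun _ => Classical.arbitrary E, measurable_const, fun s => hα.elim s⟩
  have hne : u.Nonempty := closure_nonempty_iff.1 ⟨h a, hsub ⟨a, rfl⟩⟩
  obtain ⟨c, rfl⟩ := hu.exists_eq_range hne
  have hex : ∀ s, ∃ i, dist (h s) (c i) < δ := fun s => by
    obtain ⟨_, ⟨i, rfl⟩, hi⟩ := Metric.mem_closure_iff.1 (hsub ⟨s, rfl⟩) δ hδ
    exact ⟨i, hi⟩
  refine ⟨fun s => Nat.find (hex s), c, measurable_find hex fun i => ?_,
    fun s => Nat.find_spec (hex s)⟩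
  exact (hm.dist stronglyMeasurable_const).measurableSet_lt stronglyMeasurable_const

section Partition

variable {ι : Type*}

lemma ae_measure_cell_ne_zero [Countable ι] (n : ℝ → ι) :
    ∀ᵐ s ∂μ01, μ01 (n ⁻¹' {n s}) ≠ 0 := by
  have h : ∀ᵐ s ∂μ01, ∀ i, n s = i → μ01 (n ⁻¹' {i}) ≠ 0 := by
    refine ae_all_iff.2 fun i => ?_
    by_cases hi : μ01 (n ⁻¹' {i}) = 0
    · filter_upwards [measure_eq_zero_iff_ae_notMem.1 hi] with s hs hsi
      exact absurd hsi hs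
    · exact Eventually.of_forall fun _ _ => hi
  filter_upwards [h] with s hs using hs _ rfl

variable [MeasurableSpace ι] [MeasurableSingletonClass ι] {n : ℝ → ι}

/-- The normalized indicator of the cell with label `i` of the partition induced by `n`
(zero if that cell is null). -/
def cellDensity (hn : Measurable n) (i : ι) : L1C :=
  ((μ01.real (n ⁻¹' {i}) : ℂ)⁻¹) •
    indicatorConstLp 1 (hn (measurableSet_singleton i)) (measure_ne_top μ01 _) (1 : ℂ)

lemma norm_cellDensity (hn : Measurable n) {i : ι} (hi : μ01 (n ⁻¹' {i}) ≠ 0) :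
    ‖cellDensity hn i‖ = 1 := by
  have h0 : μ01.real (n ⁻¹' {i}) ≠ 0 := by simpa [measureReal_eq_zero_iff] using hi
  rw [cellDensity, norm_smul, norm_indicatorConstLp one_ne_zero ENNReal.one_ne_top]
  simp [abs_of_nonneg, h0]

lemma norm_cellDensity_le (hn : Measurable n) (i : ι) : ‖cellDensity hn i‖ ≤ 1 := by
  by_cases hi : μ01 (n ⁻¹' {i}) = 0
  · simp [cellDensity, Measure.real, hi]
  · exact (norm_cellDensity hn hi).le

lemma map_cellDensity {E : Type*} [NormedAddCommGroup E] [NormedSpace ℂ E]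
    {T : L1C →L[ℂ] E} {h : ℝ → E} (hT : ∀ f : L1C, T f = ∫ s, (f : ℝ → ℂ) s • h s ∂μ01)
    (hn : Measurable n) (i : ι) :
    T (cellDensity hn i) = ⨍ s in n ⁻¹' {i}, h s ∂μ01 := by
  have hA := hn (measurableSet_singleton i)
  rw [cellDensity, map_smul, hT, setAverage_eq, ← integral_indicator hA, ← Complex.ofReal_inv,
    Complex.coe_smul]
  congr 1
  refine integral_congr_ae ?_
  filter_upwards [indicatorConstLp_coeFn (p := 1) (hs := hA) (hμs := measure_ne_top μ01 _)
    (c := (1 : ℂ))] with s hs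
  rw [hs]
  by_cases h : s ∈ n ⁻¹' {i} <;> simp [Set.indicator, h]

lemma setAverage_cell {E : Type*} [NormedAddCommGroup E] [NormedSpace ℂ E] [CompleteSpace E]
    (hn : Measurable n) {i : ι} (hi : μ01 (n ⁻¹' {i}) ≠ 0) (g : ι → E) :
    ⨍ s in n ⁻¹' {i}, g (n s) ∂μ01 = g i := by
  rw [setAverage_congr_fun (hn (measurableSet_singleton i)) (g := fun _ => g i),
    setAverage_const hi (measure_ne_top μ01 _)]
  refine Eventually.of_forall fun s hs => ?_
  rw [show n s = i from hs]

variable [Countable ι]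

lemma stronglyMeasurable_cellDensity (hn : Measurable n) :
    StronglyMeasurable fun s => cellDensity hn (n s) :=
  (StronglyMeasurable.of_discrete (f := cellDensity hn)).comp_measurable hn

/-- The conditional expectation onto the countable partition of `[0,1]` induced by `n`. -/
def partitionProjection (hn : Measurable n) : L1C →L[ℂ] L1C :=
  kernelOperator (fun s => cellDensity hn (n s)) 1 (stronglyMeasurable_cellDensity hn)
    (Eventually.of_forall fun _ => norm_cellDensity_le hn _)

lemma isRepresentable_partitionProjection (hn : Measurable n) :
    IsRepresentable (partitionProjection hn) :=
  ⟨_, stronglyMeasurable_cellDensity hn, ⟨1, fun _ _ => norm_cellDensity_le hn _⟩,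
    fun _ => rfl⟩

lemma comp_partitionProjection_apply {E : Type*} [NormedAddCommGroup E] [NormedSpace ℂ E]
    [CompleteSpace E] (T : L1C →L[ℂ] E) (hn : Measurable n) (f : L1C) :
    T (partitionProjection hn f) = ∫ s, (f : ℝ → ℂ) s • T (cellDensity hn (n s)) ∂μ01 :=
  map_kernelOperator _ _ T f

lemma partitionProjection_cellDensity (hn : Measurable n) {i : ι}
    (hi : μ01 (n ⁻¹' {i}) ≠ 0) :
    partitionProjection hn (cellDensity hn i) = cellDensity hn i := by
  rw [map_cellDensity (T := partitionProjection hn) (fun _ => rfl),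
    setAverage_cell hn hi (cellDensity hn)]

lemma partitionProjection_comp_self (hn : Measurable n) :
    (partitionProjection hn).comp (partitionProjection hn) = partitionProjection hn := by
  ext1 f
  rw [ContinuousLinearMap.comp_apply, comp_partitionProjection_apply]
  refine integral_congr_ae ?_
  filter_upwards [ae_measure_cell_ne_zero n] with s hs
  rw [partitionProjection_cellDensity hn hs]

lemma norm_partitionProjection (hn : Measurable n) : ‖partitionProjection hn‖ = 1 := by
  refine le_antisymm (norm_kernelOperator_le _ _ zero_le_one) ?_
  obtain ⟨s, hs⟩ := (ae_measure_cell_ne_zero n).exists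
  simpa [partitionProjection_cellDensity hn hs, norm_cellDensity hn hs] using
    (partitionProjection hn).le_opNorm (cellDensity hn (n s))

lemma norm_sub_comp_partitionProjection_le {E : Type*} [NormedAddCommGroup E] [NormedSpace ℂ E]
    [CompleteSpace E] {T : L1C →L[ℂ] E} {h : ℝ → E} {C : ℝ} (hm : StronglyMeasurable h)
    (hC : ∀ᵐ s ∂μ01, ‖h s‖ ≤ C) (hT : ∀ f : L1C, T f = ∫ s, (f : ℝ → ℂ) s • h s ∂μ01)
    (hn : Measurable n) {δ : ℝ} (hδ : 0 ≤ δ) {c : ι → E}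
    (hc : ∀ s, dist (h s) (c (n s)) ≤ δ) :
    ‖T - T.comp (partitionProjection hn)‖ ≤ 2 * δ := by
  have hint : Integrable h μ01 := Integrable.of_bound hm.aestronglyMeasurable C hC
  have hTm : StronglyMeasurable fun s => T (cellDensity hn (n s)) :=
    T.continuous.comp_stronglyMeasurable (stronglyMeasurable_cellDensity hn)
  have hTC : ∀ᵐ s ∂μ01, ‖T (cellDensity hn (n s))‖ ≤ ‖T‖ := Eventually.of_forall fun s =>
    T.le_of_opNorm_le_of_le le_rfl (norm_cellDensity_le hn _) |>.trans_eq (mul_one _)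
  have hclose : ∀ᵐ s ∂μ01, ‖h s - T (cellDensity hn (n s))‖ ≤ 2 * δ := by
    filter_upwards [ae_measure_cell_ne_zero n] with s hs
    have hmem : T (cellDensity hn (n s)) ∈ Metric.closedBall (c (n s)) δ := by
      rw [map_cellDensity hT]
      refine (convex_closedBall _ _).set_average_mem Metric.isClosed_closedBall hs
        (measure_ne_top μ01 _) ?_ hint.integrableOn
      filter_upwards [ae_restrict_mem (hn (measurableSet_singleton (n s)))] with t ht
      rw [← show n t = n s from ht]
      exact hc t
    rw [← dist_eq_norm, two_mul]
    exact (dist_triangle_right _ _ _).trans (add_le_add (hc s) hmem)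
  refine ContinuousLinearMap.opNorm_le_bound _ (by positivity) fun f => ?_
  rw [sub_apply, ContinuousLinearMap.comp_apply, comp_partitionProjection_apply, hT,
    ← integral_sub (integrable_smul_kernel hm hC f) (integrable_smul_kernel hTm hTC f)]
  simp only [← smul_sub]
  exact norm_integral_smul_kernel_le hclose f

end Partition

/-- The ideal `𝔯` of representable operators on `L₁[0,1]` has a bounded right approximate
identity, which may moreover be chosen to consist of norm-one idempotents (formulated via
the cofinal finite-set/ε criterion for the net). -/
theorem representable_operators_have_bounded_right_approximate_identity :
    ∀ (F : Finset (L1C →L[ℂ] L1C)), (∀ T ∈ F, IsRepresentable T) →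
      ∀ ε : ℝ, 0 < ε →
        ∃ P : L1C →L[ℂ] L1C, IsRepresentable P ∧ P.comp P = P ∧ ‖P‖ = 1 ∧
          ∀ T ∈ F, ‖T - T.comp P‖ < ε := by
  intro F hF ε hε
  choose h hm hC hT using fun T : F => hF T T.2
  choose C hC using hC
  choose m c hmm hc using fun T : F =>
    StronglyMeasurable.exists_measurable_nat_dist_lt (hm T) (show 0 < ε / 3 by positivity)
  have hn : Measurable fun s (T : F) => m T s := measurable_pi_lambda _ hmm
  refine ⟨partitionProjection hn, isRepresentable_partitionProjection hn,
    partitionProjection_comp_self hn, norm_partitionProjection hn, fun T hTF => ?_⟩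
  refine (norm_sub_comp_partitionProjection_le (hm ⟨T, hTF⟩)
    (ae_restrict_of_forall_mem measurableSet_Icc (hC ⟨T, hTF⟩)) (hT ⟨T, hTF⟩) hn
    (show 0 ≤ ε / 3 by positivity) (c := fun i => c ⟨T, hTF⟩ (i ⟨T, hTF⟩))
    fun s => (hc ⟨T, hTF⟩ s).le).trans_lt ?_
  linarith
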